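/- Let I = B(M,N) ⊆ S = K[x_1, …, x_n] be the strongly stable ideal with Borel generators M = x_a·x_b and N = x_c·x_d, where c < a ≤ b < d. Then the collection G₂ = { T_u T_v − T_{u'} T_{v'} : u, v, u', v' ∈ B_M ∪ B_N, u·v = u'·v', and u, v ≻_mrlex v' }, with each binomial marked at T_u T_v, is a Gröbner basis of the toric ideal T(I) = ker φ_I with respect to the mixed reverse lexicographic order ≻_mrlex on K[T_u : u ∈ B_M ∪ B_N], with the marked terms as initial terms. -/

import Mathlib

/-- A marked binomial: the difference of two monomials (given by exponent vectors),
with `head` chosen as the marked term. -/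
structure MarkedBinomial (V : Type*) where
  head : V →₀ ℕ
  tail : V →₀ ℕ

/-- The polynomial associated to a marked binomial. -/
noncomputable def MarkedBinomial.toPoly {V : Type*} (K : Type*) [Field K]
    (g : MarkedBinomial V) : MvPolynomial V K :=
  MvPolynomial.monomial g.head 1 - MvPolynomial.monomial g.tail 1

/-- Transport a marked binomial along a map of variables. -/
noncomputable def MarkedBinomial.map {V W : Type*} (f : V → W) (g : MarkedBinomial V) :
    MarkedBinomial W :=
  ⟨Finsupp.mapDomain f g.head, Finsupp.mapDomain f g.tail⟩

/-- A monomial order on the exponent vectors `V →₀ ℕ`: a strict total order, compatible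
with addition, for which `1` (the zero exponent vector) is the smallest monomial. -/
structure MonomialOrd (V : Type*) where
  gt : (V →₀ ℕ) → (V →₀ ℕ) → Prop
  irrefl : ∀ m, ¬ gt m m
  trans : ∀ {m₁ m₂ m₃}, gt m₁ m₂ → gt m₂ m₃ → gt m₁ m₃
  total : ∀ m₁ m₂, m₁ ≠ m₂ → gt m₁ m₂ ∨ gt m₂ m₁
  add_right : ∀ {m₁ m₂} (m₃), gt m₁ m₂ → gt (m₁ + m₃) (m₂ + m₃)
  gt_zero : ∀ m, m ≠ 0 → gt m 0

/-- `m` is the initial (leading) exponent of `f` with respect to the strict order `gt`. -/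
def IsInitialTerm {V K : Type*} [Field K] (gt : (V →₀ ℕ) → (V →₀ ℕ) → Prop)
    (f : MvPolynomial V K) (m : V →₀ ℕ) : Prop :=
  m ∈ f.support ∧ ∀ m' ∈ f.support, m' ≠ m → gt m m'

/-- A set `G` of marked binomials is a Gröbner basis of the ideal `J` with respect to the
order `gt`, with the marked terms as initial terms: `G ⊆ J`, each marked term is the
initial term of its binomial, and the marked terms generate the initial ideal of `J`. -/
def IsMarkedGB {V K : Type*} [Field K] (gt : (V →₀ ℕ) → (V →₀ ℕ) → Prop)
    (G : Set (MarkedBinomial V)) (J : Ideal (MvPolynomial V K)) : Prop :=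
  (∀ g ∈ G, g.toPoly K ∈ J) ∧ (∀ g ∈ G, gt g.head g.tail) ∧
    Ideal.span ((fun g => (MvPolynomial.monomial g.head (1 : K) : MvPolynomial V K)) '' G) =
      Ideal.span {p : MvPolynomial V K |
        ∃ f ∈ J, f ≠ 0 ∧ ∃ m, IsInitialTerm gt f m ∧ p = MvPolynomial.monomial m (1 : K)}

/-- One-step reduction of a monomial (exponent vector) with respect to a collection of
marked binomials: replace an occurrence of a marked term by the corresponding tail. -/
def Reduces {V : Type*} (G : Set (MarkedBinomial V)) (m m' : V →₀ ℕ) : Prop :=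
  ∃ g ∈ G, g.head ≤ m ∧ m' = m - g.head + g.tail

/-- One-step reduction of a polynomial with respect to a collection of marked binomials. -/
noncomputable def PolyReduces {V K : Type*} [Field K] (G : Set (MarkedBinomial V))
    (f f' : MvPolynomial V K) : Prop :=
  ∃ g ∈ G, ∃ m ∈ f.support, g.head ≤ m ∧
    f' = f - MvPolynomial.monomial (m - g.head) (MvPolynomial.coeff m f) * g.toPoly K

/-- The image monomial (in the `W`-variables) of a monomial `T` in the `V`-variables under
the monomial map sending the variable `v` to the monomial with exponent vector `u v`. -/
noncomputable def fiberMap {V W : Type*} (u : V → (W →₀ ℕ)) (T : V →₀ ℕ) : W →₀ ℕ :=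
  T.sum fun v e => e • u v

/-- `T` is a sink of the fiber graph over the multidegree `μ` (with respect to the
marked binomials `G` and the monomial map determined by `u`): it lies in the fiber and
has no outgoing edge inside the fiber. -/
noncomputable def IsFiberSink {V W : Type*} (G : Set (MarkedBinomial V)) (u : V → (W →₀ ℕ))
    (μ : W →₀ ℕ) (T : V →₀ ℕ) : Prop :=
  fiberMap u T = μ ∧ ∀ T', Reduces G T T' → fiberMap u T' ≠ μ

/-- `I` is a monomial ideal. -/
def IsMonomialIdeal {n : ℕ} {K : Type*} [Field K] (I : Ideal (MvPolynomial (Fin n) K)) : Prop :=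
  ∃ M : Set (Fin n →₀ ℕ), I = Ideal.span ((fun m => (MvPolynomial.monomial m (1 : K))) '' M)

/-- `I` is a strongly stable (Borel) ideal: a monomial ideal such that whenever `x_i`
divides a monomial `m ∈ I` and `j < i`, also `x_j · m / x_i ∈ I`. -/
def StronglyStable {n : ℕ} {K : Type*} [Field K] (I : Ideal (MvPolynomial (Fin n) K)) : Prop :=
  IsMonomialIdeal I ∧ ∀ m : Fin n →₀ ℕ, MvPolynomial.monomial m (1 : K) ∈ I →
    ∀ i j : Fin n, j < i → m i ≠ 0 →
      MvPolynomial.monomial (m - Finsupp.single i 1 + Finsupp.single j 1) (1 : K) ∈ I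

/-- The smallest strongly stable ideal containing the given monomials. -/
noncomputable def smallestStronglyStable {n : ℕ} (K : Type*) [Field K]
    (Ms : Set (Fin n →₀ ℕ)) : Ideal (MvPolynomial (Fin n) K) :=
  sInf {I | StronglyStable I ∧ ∀ m ∈ Ms, MvPolynomial.monomial m (1 : K) ∈ I}

/-- The minimal monomial generators of an ideal generated in the single degree `d`:
the degree-`d` monomials lying in `I`. -/
def MinGens {n : ℕ} {K : Type*} [Field K] (I : Ideal (MvPolynomial (Fin n) K)) (d : ℕ) :
    Set (Fin n →₀ ℕ) :=
  {m | (m.sum fun _ e => e) = d ∧ MvPolynomial.monomial m (1 : K) ∈ I}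

/-- `u ≻_rlex v` (reverse lexicographic, `x_1 > … > x_n`, for exponent vectors of equal
total degree): at the largest index where they differ, `u` has the smaller exponent. -/
def RlexGt {n : ℕ} (u v : Fin n →₀ ℕ) : Prop :=
  ∃ k : Fin n, u k < v k ∧ ∀ l : Fin n, k < l → u l = v l

/-- The (degree-)reverse lexicographic order on monomials of `K[V]` induced by the strict
variable order `vgt` (where `vgt k l` means the variable `k` is greater than `l`). -/
def VarRevlexGt {V : Type*} (vgt : V → V → Prop) (m m' : V →₀ ℕ) : Prop :=
  (m.sum fun _ e => e) > (m'.sum fun _ e => e) ∨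
    ((m.sum fun _ e => e) = (m'.sum fun _ e => e) ∧
      ∃ k, m k < m' k ∧ ∀ l, vgt k l → m l = m' l)

/-- The minimal monomial generators of the strongly stable ideal `B(x_a x_b)` (`a ≤ b`):
the monomials `x_i x_j` with `i ≤ j`, `i ≤ a`, `j ≤ b`. -/
def BM {n : ℕ} (a b : Fin n) : Set (Fin n →₀ ℕ) :=
  {m | ∃ i j : Fin n, i ≤ j ∧ i ≤ a ∧ j ≤ b ∧ m = Finsupp.single i 1 + Finsupp.single j 1}

/-- The minimal monomial generators of `B(x_c x_d)` not in `B(x_a x_b)` (for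
`c < a ≤ b < d`): the monomials `x_i x_j` with `i ≤ c` and `b < j ≤ d`. -/
def BN {n : ℕ} (b c d : Fin n) : Set (Fin n →₀ ℕ) :=
  {m | ∃ i j : Fin n, i ≤ c ∧ b < j ∧ j ≤ d ∧ m = Finsupp.single i 1 + Finsupp.single j 1}

/-- `u ≻_mrlex v`: every element of `B_N` is greater than every element of `B_M`, and
within `B_M` (resp. `B_N`) the order agrees with `≻_rlex`. -/
def MrlexGt {n : ℕ} (a b c d : Fin n) (u v : Fin n →₀ ℕ) : Prop :=
  (u ∈ BN b c d ∧ v ∈ BM a b) ∨ (u ∈ BM a b ∧ v ∈ BM a b ∧ RlexGt u v) ∨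
    (u ∈ BN b c d ∧ v ∈ BN b c d ∧ RlexGt u v)

/-- The collection `G₁` of marked binomials `T_u T_v − T_{u'} T_{v'}` with `u v = u' v'`
and `u, v ≻_rlex v'`, marked at `T_u T_v`. -/
def G1 {n : ℕ} (a b c d : Fin n) : Set (MarkedBinomial ↥(BM a b ∪ BN b c d)) :=
  {g | ∃ u v u' v' : ↥(BM a b ∪ BN b c d),
    (u : Fin n →₀ ℕ) + (v : Fin n →₀ ℕ) = (u' : Fin n →₀ ℕ) + (v' : Fin n →₀ ℕ) ∧
    RlexGt (u : Fin n →₀ ℕ) (v' : Fin n →₀ ℕ) ∧ RlexGt (v : Fin n →₀ ℕ) (v' : Fin n →₀ ℕ) ∧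
    g.head = Finsupp.single u 1 + Finsupp.single v 1 ∧
    g.tail = Finsupp.single u' 1 + Finsupp.single v' 1}

/-- The collection `G₂` of marked binomials `T_u T_v − T_{u'} T_{v'}` with `u v = u' v'`
and `u, v ≻_mrlex v'`, marked at `T_u T_v`. -/
def G2 {n : ℕ} (a b c d : Fin n) : Set (MarkedBinomial ↥(BM a b ∪ BN b c d)) :=
  {g | ∃ u v u' v' : ↥(BM a b ∪ BN b c d),
    (u : Fin n →₀ ℕ) + (v : Fin n →₀ ℕ) = (u' : Fin n →₀ ℕ) + (v' : Fin n →₀ ℕ) ∧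
    MrlexGt a b c d (u : Fin n →₀ ℕ) (v' : Fin n →₀ ℕ) ∧
    MrlexGt a b c d (v : Fin n →₀ ℕ) (v' : Fin n →₀ ℕ) ∧
    g.head = Finsupp.single u 1 + Finsupp.single v 1 ∧
    g.tail = Finsupp.single u' 1 + Finsupp.single v' 1}

/-- `w` is the smallest (with respect to the variable order induced by `≻_rlex`) variable
factor of the monomial `T` whose underlying monomial lies in `S`. -/
def IsLeastFactorIn {n : ℕ} {V : Set (Fin n →₀ ℕ)} (S : Set (Fin n →₀ ℕ))
    (T : ↥V →₀ ℕ) (w : ↥V) : Prop :=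
  w ∈ T.support ∧ (w : Fin n →₀ ℕ) ∈ S ∧
    ∀ v ∈ T.support, (v : Fin n →₀ ℕ) ∈ S →
      v = w ∨ RlexGt (v : Fin n →₀ ℕ) (w : Fin n →₀ ℕ)

/-- `m` is the `≻_rlex`-smallest element of `S` dividing `μ`. -/
def IsLeastDivisorIn {n : ℕ} (S : Set (Fin n →₀ ℕ)) (μ m : Fin n →₀ ℕ) : Prop :=
  m ∈ S ∧ m ≤ μ ∧ ∀ m' ∈ S, m' ≤ μ → m' = m ∨ RlexGt m' m

section RevLex

variable {n : ℕ}

theorem RlexGt.irrefl (u : Fin n →₀ ℕ) : ¬ RlexGt u u :=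
  fun ⟨_, h, _⟩ => lt_irrefl _ h

theorem RlexGt.trans {u v w : Fin n →₀ ℕ} (huv : RlexGt u v) (hvw : RlexGt v w) :
    RlexGt u w := by
  obtain ⟨k, hk, hk'⟩ := huv
  obtain ⟨l, hl, hl'⟩ := hvw
  rcases lt_trichotomy k l with h | rfl | h
  · exact ⟨l, by rw [hk' l h]; exact hl, fun i hi => (hk' i (h.trans hi)).trans (hl' i hi)⟩
  · exact ⟨k, hk.trans hl, fun i hi => (hk' i hi).trans (hl' i hi)⟩
  · exact ⟨k, by rw [← hl' k h]; exact hk, fun i hi => (hk' i hi).trans (hl' i (h.trans hi))⟩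

theorem RlexGt.total {u v : Fin n →₀ ℕ} (h : u ≠ v) : RlexGt u v ∨ RlexGt v u := by
  classical
  have hne : (Finset.univ.filter fun i => u i ≠ v i).Nonempty := by
    obtain ⟨i, hi⟩ := DFunLike.ne_iff.mp h
    exact ⟨i, by simpa using hi⟩
  obtain ⟨k, hk, hmax⟩ := Finset.exists_max_image _ id hne
  have heq : ∀ l, k < l → u l = v l := fun l hl => by
    by_contra hne
    exact absurd (hmax l (by simpa using hne)) (not_le.mpr hl)
  rcases lt_or_gt_of_ne (Finset.mem_filter.mp hk).2 with h | h
  · exact Or.inl ⟨k, h, heq⟩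
  · exact Or.inr ⟨k, h, fun l hl => (heq l hl).symm⟩

theorem rlexGt_add_left_iff (w u v : Fin n →₀ ℕ) : RlexGt (w + u) (w + v) ↔ RlexGt u v := by
  simp [RlexGt]

theorem rlexGt_single_iff (i j : Fin n) :
    RlexGt (Finsupp.single i 1) (Finsupp.single j 1) ↔ i < j := by
  constructor
  · rintro ⟨k, hk, h⟩
    have hkj : j = k := by
      by_contra hne
      simp [Finsupp.single_apply, hne] at hk
    subst hkj
    by_contra hij
    rcases (not_lt.mp hij).eq_or_lt with rfl | hlt
    · exact lt_irrefl _ hk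
    · have := h i hlt
      simp [hlt.ne] at this
  · intro h
    refine ⟨j, by simp [h.ne], fun l hl => ?_⟩
    simp [hl.ne, (h.trans hl).ne]

theorem RlexGt.lt_or_eq_and_lt {e f i j : Fin n} (hij : i ≤ j)
    (h : RlexGt (Finsupp.single e 1 + Finsupp.single f 1)
      (Finsupp.single i 1 + Finsupp.single j 1)) : f < j ∨ f = j ∧ e < i := by
  rcases lt_trichotomy f j with hlt | rfl | hgt
  · exact Or.inl hlt
  · refine Or.inr ⟨rfl, ?_⟩
    rwa [add_comm, add_comm (Finsupp.single i 1), rlexGt_add_left_iff, rlexGt_single_iff] at h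
  · obtain ⟨k, hk, hk'⟩ := h
    have hkj : k ≤ j := by
      by_contra hjk
      have hjk := not_le.mp hjk
      simp [Finsupp.single_apply, hjk.ne, (hij.trans_lt hjk).ne] at hk
    have := hk' f (hkj.trans_lt hgt)
    simp [Finsupp.single_apply, hgt.ne, (hij.trans_lt hgt).ne] at this

end RevLex

section Generators

variable {n : ℕ} {a b c d : Fin n}

theorem not_mem_BN_of_mem_BM (h2 : a ≤ b) {u : Fin n →₀ ℕ} (hu : u ∈ BM a b) :
    u ∉ BN b c d := by
  obtain ⟨i, j, -, hia, hjb, rfl⟩ := hu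
  rintro ⟨p, q, -, hbq, -, h⟩
  have := DFunLike.congr_fun h q
  simp [Finsupp.single_apply, ((hia.trans h2).trans_lt hbq).ne, (hjb.trans_lt hbq).ne] at this

theorem single_add_single_mem_BM {i j : Fin n} (h2 : a ≤ b) (hi : i ≤ a) (hj : j ≤ b) :
    Finsupp.single i 1 + Finsupp.single j 1 ∈ BM a b := by
  rcases le_total i j with h | h
  · exact ⟨i, j, h, hi, hj, rfl⟩
  · exact ⟨j, i, h, h.trans hi, hi.trans h2, add_comm _ _⟩

theorem MrlexGt.irrefl (h2 : a ≤ b) (u : Fin n →₀ ℕ) : ¬ MrlexGt a b c d u u := by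
  rintro (⟨h, h'⟩ | ⟨-, -, h⟩ | ⟨-, -, h⟩)
  · exact not_mem_BN_of_mem_BM h2 h' h
  · exact RlexGt.irrefl _ h
  · exact RlexGt.irrefl _ h

theorem MrlexGt.trans (h2 : a ≤ b) {u v w : Fin n →₀ ℕ} (huv : MrlexGt a b c d u v)
    (hvw : MrlexGt a b c d v w) : MrlexGt a b c d u w := by
  have hdis : ∀ x ∈ BM a b, x ∉ BN b c d := fun _ => not_mem_BN_of_mem_BM h2
  rcases huv with ⟨hu, hv⟩ | ⟨hu, hv, h⟩ | ⟨hu, hv, h⟩ <;>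
    rcases hvw with ⟨hv', hw⟩ | ⟨hv', hw, h'⟩ | ⟨hv', hw, h'⟩
  all_goals first
    | exact absurd hv' (hdis _ hv)
    | exact absurd hv (hdis _ hv')
    | exact Or.inl ⟨hu, hw⟩
    | exact Or.inr (Or.inl ⟨hu, hw, h.trans h'⟩)
    | exact Or.inr (Or.inr ⟨hu, hw, h.trans h'⟩)

theorem MrlexGt.total {u v : Fin n →₀ ℕ} (hu : u ∈ BM a b ∪ BN b c d)
    (hv : v ∈ BM a b ∪ BN b c d) (h : u ≠ v) : MrlexGt a b c d u v ∨ MrlexGt a b c d v u := by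
  have := RlexGt.total h
  unfold MrlexGt
  simp only [Set.mem_union] at hu hv
  tauto

theorem exists_eq_single_add_single {u : Fin n →₀ ℕ} {i : Fin n}
    (hu : u ∈ BM a b ∪ BN b c d) (hi : u i ≠ 0) :
    ∃ s, u = Finsupp.single i 1 + Finsupp.single s 1 := by
  obtain ⟨p, q, rfl⟩ : ∃ p q, u = Finsupp.single p 1 + Finsupp.single q 1 := by
    rcases hu with ⟨p, q, -, -, -, h⟩ | ⟨p, q, -, -, -, h⟩ <;> exact ⟨p, q, h⟩
  by_cases hp : p = i
  · exact ⟨q, by rw [hp]⟩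
  · by_cases hq : q = i
    · exact ⟨p, by rw [hq, add_comm]⟩
    · simp [hp, hq] at hi

theorem lt_of_single_add_single_mem_BN (h2 : a ≤ b) (h1 : c < a) {i s : Fin n} (hi : i ≤ b)
    (h : Finsupp.single i 1 + Finsupp.single s 1 ∈ BN b c d) : i ≤ c ∧ b < s ∧ s ≤ d := by
  obtain ⟨p, q, hp, hq, hqd, h⟩ := h
  have hpb : p ≤ b := hp.trans (h1.le.trans h2)
  have hs : s = q := by
    by_contra hne
    have := DFunLike.congr_fun h q
    simp [Finsupp.single_apply, (hi.trans_lt hq).ne, hne] at this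
  subst hs
  have := add_right_cancel h
  rw [Finsupp.single_left_inj one_ne_zero] at this
  exact ⟨this ▸ hp, hq, hqd⟩

theorem le_of_single_add_single_mem_BN (h2 : a ≤ b) (h1 : c < a) {j t : Fin n} (hj : b < j)
    (h : Finsupp.single j 1 + Finsupp.single t 1 ∈ BN b c d) : t ≤ c := by
  obtain ⟨p, q, hp, hq, hqd, h⟩ := h
  have hpj : p ≠ j := ((hp.trans (h1.le.trans h2)).trans_lt hj).ne
  have hqj : q = j := by
    by_contra hne
    have := DFunLike.congr_fun h j
    simp [Finsupp.single_apply, hpj, hne] at this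
  subst hqj
  rw [add_comm] at h
  have := add_right_cancel h
  rw [Finsupp.single_left_inj one_ne_zero] at this
  exact this ▸ hp

end Generators

section FiberMap

variable {V W : Type*}

theorem fiberMap_eq_linearCombination (u : V → W →₀ ℕ) (T : V →₀ ℕ) :
    fiberMap u T = Finsupp.linearCombination ℕ u T :=
  rfl

theorem map_fiberMap {M : Type*} [AddCommMonoid M] (L : (W →₀ ℕ) →ₗ[ℕ] M) (u : V → W →₀ ℕ)
    (T : V →₀ ℕ) : L (fiberMap u T) = T.sum fun v e => e • L (u v) := by
  simp [fiberMap, map_finsuppSum]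

theorem fiberMap_add (u : V → W →₀ ℕ) (A B : V →₀ ℕ) :
    fiberMap u (A + B) = fiberMap u A + fiberMap u B := by
  simp only [fiberMap_eq_linearCombination, map_add]

theorem fiberMap_single (u : V → W →₀ ℕ) (v : V) : fiberMap u (Finsupp.single v 1) = u v := by
  simp [fiberMap]

theorem exists_mem_support_of_fiberMap_ne_zero {u : V → W →₀ ℕ} {A : V →₀ ℕ} {i : W}
    (h : fiberMap u A i ≠ 0) : ∃ v ∈ A.support, u v i ≠ 0 := by
  by_contra! hcon
  apply h
  rw [fiberMap, Finsupp.sum, Finsupp.finsetSum_apply]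
  exact Finset.sum_eq_zero fun v hv => by simp [hcon v hv]

theorem single_add_tsub_of_mem_support {A : V →₀ ℕ} {v : V} (hv : v ∈ A.support) :
    Finsupp.single v 1 + (A - Finsupp.single v 1) = A :=
  add_tsub_cancel_of_le (Finsupp.single_le_iff.mpr
    (Nat.one_le_iff_ne_zero.mpr (Finsupp.mem_support_iff.mp hv)))

theorem aeval_monomial_fiberMap {K : Type*} [CommSemiring K] (u : V → W →₀ ℕ) (m : V →₀ ℕ)
    (r : K) : MvPolynomial.aeval (fun v => MvPolynomial.monomial (u v) (1 : K))
      (MvPolynomial.monomial m r) = MvPolynomial.monomial (fiberMap u m) r := by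
  rw [MvPolynomial.aeval_monomial, fiberMap, MvPolynomial.monomial_finsupp_sum_index]
  simp [MvPolynomial.algebraMap_eq, MvPolynomial.monomial_pow]

theorem le_fiberMap_of_mem_support {u : V → W →₀ ℕ} {A : V →₀ ℕ} {v : V}
    (hv : v ∈ A.support) : u v ≤ fiberMap u A := by
  rw [← single_add_tsub_of_mem_support hv, fiberMap_add, fiberMap_single]
  exact le_self_add

theorem single_add_single_le {A : V →₀ ℕ} {v w : V} (hv : v ∈ A.support)
    (hw : w ∈ (A - Finsupp.single v 1).support) :
    Finsupp.single v 1 + Finsupp.single w 1 ≤ A := by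
  conv_rhs => rw [← single_add_tsub_of_mem_support hv, ← single_add_tsub_of_mem_support hw]
  exact add_le_add_right le_self_add _

theorem mem_support_tsub_single_of_ne {A : V →₀ ℕ} {v w : V} (h : v ≠ w)
    (hw : w ∈ A.support) : w ∈ (A - Finsupp.single v 1).support := by
  classical
  simpa [Finsupp.single_apply, h] using hw

theorem exists_ne_mem_support_fiberMap_eq {K : Type*} [CommSemiring K] {u : V → W →₀ ℕ}
    {f : MvPolynomial V K} {m : V →₀ ℕ} (hm : m ∈ f.support)
    (hf : MvPolynomial.aeval (fun v => MvPolynomial.monomial (u v) (1 : K)) f = 0) :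
    ∃ m' ∈ f.support, m' ≠ m ∧ fiberMap u m' = fiberMap u m := by
  classical
  by_contra! hcon
  rw [f.as_sum, map_sum] at hf
  have hcoeff := congrArg (MvPolynomial.coeff (fiberMap u m)) hf
  rw [MvPolynomial.coeff_sum, Finset.sum_eq_single_of_mem m hm] at hcoeff
  · rw [aeval_monomial_fiberMap] at hcoeff
    exact MvPolynomial.mem_support_iff.mp hm (by simpa using hcoeff)
  · intro m' hm' hne
    rw [aeval_monomial_fiberMap, MvPolynomial.coeff_monomial, if_neg (hcon m' hm' hne)]

end FiberMap

section GroebnerBasis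

variable {n : ℕ} {a b c d : Fin n}

theorem degree_fiberMap (A : ↥(BM a b ∪ BN b c d) →₀ ℕ) :
    (fiberMap Subtype.val A).degree = 2 * A.degree := by
  have hgen : ∀ v : ↥(BM a b ∪ BN b c d), Finsupp.degree (v : Fin n →₀ ℕ) = 2 := by
    rintro ⟨v, ⟨p, q, -, -, -, rfl⟩ | ⟨p, q, -, -, -, rfl⟩⟩ <;> simp
  induction A using Finsupp.induction_linear with
  | zero => simp [fiberMap]
  | add f g hf hg => rw [fiberMap_add, map_add, hf, hg, map_add, mul_add]
  | single v e => simp [fiberMap, hgen, mul_comm]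

theorem exists_mem_support_mem_BM (h1 : c < a) (h2 : a ≤ b)
    {A B : ↥(BM a b ∪ BN b c d) →₀ ℕ} (hAB : fiberMap Subtype.val A = fiberMap Subtype.val B)
    {k : ↥(BM a b ∪ BN b c d)} (hk : k ∈ B.support) (hkM : (k : Fin n →₀ ℕ) ∈ BM a b) :
    ∃ w ∈ A.support, (w : Fin n →₀ ℕ) ∈ BM a b := by
  by_contra! hcon
  let L := Finsupp.linearCombination ℕ fun i : Fin n => if i ≤ b then (1 : ℤ) else -1
  have hM : ∀ v ∈ BM a b, L v = 2 := by
    rintro _ ⟨p, q, -, hp, hq, rfl⟩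
    simp [L, hp.trans h2, hq]
  have hN : ∀ v ∈ BN b c d, L v = 0 := by
    rintro _ ⟨p, q, hp, hq, -, rfl⟩
    simp [L, hp.trans (h1.le.trans h2), not_le.mpr hq]
  have hA : L (fiberMap Subtype.val A) = 0 := by
    rw [map_fiberMap]
    refine Finset.sum_eq_zero fun v hv => ?_
    simp [hN _ (v.2.resolve_left (hcon v hv))]
  have hB : 0 < L (fiberMap Subtype.val B) := by
    rw [map_fiberMap]
    refine Finset.sum_pos' (fun v _ => nsmul_nonneg ?_ _) ⟨k, hk, ?_⟩
    · rcases v.2 with h | h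
      · rw [hM _ h]; norm_num
      · rw [hN _ h]
    · simpa [hM _ hkM, Nat.pos_iff_ne_zero] using hk
  rw [← hAB, hA] at hB
  exact lt_irrefl _ hB

theorem exists_factor_pair {A : ↥(BM a b ∪ BN b c d) →₀ ℕ} {i j : Fin n}
    (hle : Finsupp.single i 1 + Finsupp.single j 1 ≤ fiberMap Subtype.val A)
    (hA : ∀ l ∈ A.support, (l : Fin n →₀ ℕ) ≠ Finsupp.single i 1 + Finsupp.single j 1) :
    ∃ p q : ↥(BM a b ∪ BN b c d), ∃ s t : Fin n,
      Finsupp.single p 1 + Finsupp.single q 1 ≤ A ∧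
      p ∈ A.support ∧ q ∈ A.support ∧
      (p : Fin n →₀ ℕ) = Finsupp.single i 1 + Finsupp.single s 1 ∧
      (q : Fin n →₀ ℕ) = Finsupp.single j 1 + Finsupp.single t 1 := by
  have hi : fiberMap Subtype.val A i ≠ 0 := by
    have := hle i
    simp at this
    omega
  obtain ⟨p, hp, hpi⟩ := exists_mem_support_of_fiberMap_ne_zero hi
  obtain ⟨s, hs⟩ := exists_eq_single_add_single p.2 hpi
  have hsj : s ≠ j := fun h => hA p hp (by rw [hs, h])
  have hj : fiberMap Subtype.val (A - Finsupp.single p 1) j ≠ 0 := by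
    rw [← single_add_tsub_of_mem_support hp, fiberMap_add, fiberMap_single, hs, add_assoc] at hle
    have := le_of_add_le_add_left hle j
    simp [hsj] at this
    omega
  obtain ⟨q, hq, hqj⟩ := exists_mem_support_of_fiberMap_ne_zero hj
  obtain ⟨t, ht⟩ := exists_eq_single_add_single q.2 hqj
  have hpq := single_add_single_le hp hq
  exact ⟨p, q, s, t, hpq, hp, Finsupp.support_mono tsub_le_self hq, hs, ht⟩

theorem exists_head_le_of_pair {A : ↥(BM a b ∪ BN b c d) →₀ ℕ} {p q : ↥(BM a b ∪ BN b c d)}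
    {v w : Fin n →₀ ℕ} (hpq : Finsupp.single p 1 + Finsupp.single q 1 ≤ A)
    (hw : w ∈ BM a b ∪ BN b c d) (hv : v ∈ BM a b ∪ BN b c d)
    (h : (p : Fin n →₀ ℕ) + (q : Fin n →₀ ℕ) = w + v)
    (hpv : MrlexGt a b c d p v) (hqv : MrlexGt a b c d q v) :
    ∃ g ∈ G2 a b c d, g.head ≤ A :=
  ⟨⟨_, Finsupp.single ⟨w, hw⟩ 1 + Finsupp.single ⟨v, hv⟩ 1⟩,
    ⟨p, q, ⟨w, hw⟩, ⟨v, hv⟩, h, hpv, hqv, rfl, rfl⟩, hpq⟩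

theorem exists_head_le_of_fiberMap_eq (h1 : c < a) (h2 : a ≤ b)
    {A B : ↥(BM a b ∪ BN b c d) →₀ ℕ} (hAB : fiberMap Subtype.val A = fiberMap Subtype.val B)
    {k : ↥(BM a b ∪ BN b c d)} (hk : k ∈ B.support)
    (hA : ∀ l ∈ A.support, MrlexGt a b c d (l : Fin n →₀ ℕ) (k : Fin n →₀ ℕ)) :
    ∃ g ∈ G2 a b c d, g.head ≤ A := by
  have hdis : ∀ x ∈ BM a b, x ∉ BN b c d := fun _ => not_mem_BN_of_mem_BM h2
  have hle : (k : Fin n →₀ ℕ) ≤ fiberMap Subtype.val A :=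
    hAB ▸ le_fiberMap_of_mem_support (u := Subtype.val) hk
  have hne : ∀ l ∈ A.support, (l : Fin n →₀ ℕ) ≠ k := fun l hl h =>
    MrlexGt.irrefl h2 _ (h ▸ hA l hl)
  rcases k.2 with hkM | hkN
  · have hrlex : ∀ l ∈ A.support, (l : Fin n →₀ ℕ) ∈ BM a b → RlexGt (l : Fin n →₀ ℕ) k := by
      intro l hl hlM
      rcases hA l hl with h | h | h
      · exact absurd h.1 (hdis _ hlM)
      · exact h.2.2
      · exact h.2.2
    obtain ⟨i, j, hij, hia, hjb, hkij⟩ := id hkM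
    have hib : i ≤ b := hij.trans hjb
    rw [hkij] at hle hne
    obtain ⟨p, q, s, t, hpq, hp, hq, hps, hqt⟩ := exists_factor_pair hle hne
    have hsum : (p : Fin n →₀ ℕ) + (q : Fin n →₀ ℕ) =
        Finsupp.single t 1 + Finsupp.single s 1 + (k : Fin n →₀ ℕ) := by
      rw [hps, hqt, hkij]; abel
    have hlt_of_p : (p : Fin n →₀ ℕ) ∈ BM a b → s < j := fun h => by
      have := hrlex p hp h
      rwa [hps, hkij, rlexGt_add_left_iff, rlexGt_single_iff] at this
    have hlt_of_q : (q : Fin n →₀ ℕ) ∈ BM a b → t < i := fun h => by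
      have := hrlex q hq h
      rwa [hqt, hkij, add_comm (Finsupp.single i 1), rlexGt_add_left_iff,
        rlexGt_single_iff] at this
    rcases p.2 with hpM | hpN <;> rcases q.2 with hqM | hqN
    · exact exists_head_le_of_pair hpq (Or.inl (single_add_single_mem_BM h2
        ((hlt_of_q hqM).le.trans hia) ((hlt_of_p hpM).le.trans hjb))) k.2 hsum (hA p hp) (hA q hq)
    · obtain ⟨hjc, hbt, htd⟩ := lt_of_single_add_single_mem_BN h2 h1 hjb (hqt ▸ hqN)
      exact exists_head_le_of_pair hpq
        (Or.inr ⟨s, t, (hlt_of_p hpM).le.trans hjc, hbt, htd, add_comm _ _⟩) k.2 hsum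
        (hA p hp) (hA q hq)
    · obtain ⟨hic, hbs, hsd⟩ := lt_of_single_add_single_mem_BN h2 h1 hib (hps ▸ hpN)
      exact exists_head_le_of_pair hpq
        (Or.inr ⟨t, s, (hlt_of_q hqM).le.trans hic, hbs, hsd, rfl⟩) k.2 hsum
        (hA p hp) (hA q hq)
    · obtain ⟨hic, hbs, hsd⟩ := lt_of_single_add_single_mem_BN h2 h1 hib (hps ▸ hpN)
      obtain ⟨hjc, hbt, htd⟩ := lt_of_single_add_single_mem_BN h2 h1 hjb (hqt ▸ hqN)
      obtain ⟨w, hw, hwM⟩ := exists_mem_support_mem_BM h1 h2 hAB hk hkM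
      have hlew : ∀ r ∈ A.support, (r : Fin n →₀ ℕ) ∈ BN b c d →
          Finsupp.single w 1 + Finsupp.single r 1 ≤ A := fun r hr hrN =>
        single_add_single_le hw (mem_support_tsub_single_of_ne
          (fun h => hdis _ hwM (h ▸ hrN)) hr)
      have hwk := hrlex w hw hwM
      obtain ⟨e, f, hef, hea, hfb, hwef⟩ := id hwM
      rw [hwef, hkij] at hwk
      rcases hwk.lt_or_eq_and_lt hij with hfj | ⟨rfl, hei⟩
      · have hv : Finsupp.single e 1 + Finsupp.single j 1 ∈ BM a b :=
          single_add_single_mem_BM h2 hea hjb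
        refine exists_head_le_of_pair (hlew q hq hqN) (Or.inr ⟨f, t, hfj.le.trans hjc, hbt, htd, rfl⟩)
          (Or.inl hv) (by rw [hwef, hqt]; abel) (Or.inr (Or.inl ⟨hwM, hv, ?_⟩)) (Or.inl ⟨hqN, hv⟩)
        rwa [hwef, rlexGt_add_left_iff, rlexGt_single_iff]
      · have hv : Finsupp.single i 1 + Finsupp.single f 1 ∈ BM a b :=
          single_add_single_mem_BM h2 hia hfb
        refine exists_head_le_of_pair (hlew p hp hpN)
          (Or.inr ⟨e, s, hei.le.trans hic, hbs, hsd, rfl⟩)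
          (Or.inl hv) (by rw [hwef, hps]; abel) (Or.inr (Or.inl ⟨hwM, hv, ?_⟩)) (Or.inl ⟨hpN, hv⟩)
        rwa [hwef]
  · have hAN : ∀ l ∈ A.support, (l : Fin n →₀ ℕ) ∈ BN b c d := by
      intro l hl
      rcases hA l hl with h | h | h
      · exact h.1
      · exact absurd hkN (hdis _ h.2.1)
      · exact h.1
    obtain ⟨i, j, hic, hbj, hjd, hkij⟩ := id hkN
    rw [hkij] at hle hne
    obtain ⟨p, q, s, t, hpq, hp, hq, hps, hqt⟩ := exists_factor_pair hle hne
    obtain ⟨-, hbs, hsd⟩ := lt_of_single_add_single_mem_BN h2 h1 (hic.trans (h1.le.trans h2))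
      (hps ▸ hAN p hp)
    have htc := le_of_single_add_single_mem_BN h2 h1 hbj (hqt ▸ hAN q hq)
    exact exists_head_le_of_pair hpq (Or.inr ⟨t, s, htc, hbs, hsd, rfl⟩) k.2
      (by rw [hps, hqt, hkij]; abel) (hA p hp) (hA q hq)

theorem exists_head_le_of_varRevlexGt (h1 : c < a) (h2 : a ≤ b)
    {m m' : ↥(BM a b ∪ BN b c d) →₀ ℕ} (hfib : fiberMap Subtype.val m = fiberMap Subtype.val m')
    (hgt : VarRevlexGt (fun w w' : ↥(BM a b ∪ BN b c d) =>
      MrlexGt a b c d (w : Fin n →₀ ℕ) (w' : Fin n →₀ ℕ)) m m') :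
    ∃ g ∈ G2 a b c d, g.head ≤ m := by
  have hdeg : m.degree = m'.degree := by
    have := congrArg Finsupp.degree hfib
    rw [degree_fiberMap, degree_fiberMap] at this
    omega
  rcases hgt with hgt | ⟨-, k, hk, hk'⟩
  · exact absurd hdeg (ne_of_gt hgt)
  · have hcancel : fiberMap Subtype.val (m - m') = fiberMap Subtype.val (m' - m) := by
      have h : m - m' + m' = m' - m + m := by
        ext v
        simp only [Finsupp.add_apply, Finsupp.tsub_apply]
        omega
      have := congrArg (fiberMap Subtype.val) h
      rw [fiberMap_add, fiberMap_add, hfib] at this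
      exact add_right_cancel this
    obtain ⟨g, hg, hle⟩ := exists_head_le_of_fiberMap_eq h1 h2 hcancel (k := k)
      (by simpa [Nat.sub_eq_zero_iff_le] using hk) (by
        intro l hl
        have hl : m' l < m l := by simpa [Nat.sub_eq_zero_iff_le] using hl
        have hlk : (l : Fin n →₀ ℕ) ≠ k := fun h => by
          obtain rfl := Subtype.ext h
          omega
        refine (MrlexGt.total l.2 k.2 hlk).resolve_right fun h => ?_
        have := hk' l h
        omega)
    exact ⟨g, hg, hle.trans tsub_le_self⟩

theorem varRevlexGt_of_mem_G2 (h2 : a ≤ b) {g : MarkedBinomial ↥(BM a b ∪ BN b c d)}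
    (hg : g ∈ G2 a b c d) :
    VarRevlexGt (fun w w' : ↥(BM a b ∪ BN b c d) =>
      MrlexGt a b c d (w : Fin n →₀ ℕ) (w' : Fin n →₀ ℕ)) g.head g.tail := by
  classical
  obtain ⟨u, v, u', v', -, hu, hv, hhead, htail⟩ := hg
  have hne : ∀ {x y : ↥(BM a b ∪ BN b c d)},
      MrlexGt a b c d (x : Fin n →₀ ℕ) (y : Fin n →₀ ℕ) → x ≠ y := fun h hxy =>
    MrlexGt.irrefl h2 _ (hxy ▸ h)
  rw [hhead, htail]
  refine Or.inr ⟨by simp [Finsupp.sum_add_index'], ?_⟩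
  by_cases h : MrlexGt a b c d (v' : Fin n →₀ ℕ) (u' : Fin n →₀ ℕ)
  · refine ⟨u', ?_, fun l hl => ?_⟩
    · simp [Finsupp.single_apply, hne (hu.trans h2 h), hne (hv.trans h2 h)]
    · have hl' := h.trans h2 hl
      simp [hne (hu.trans h2 hl'), hne (hv.trans h2 hl'), hne hl, hne hl']
  · refine ⟨v', ?_, fun l hl => ?_⟩
    · simp [Finsupp.single_apply, hne hu, hne hv]
    · have hul : u' ≠ l := fun hul => h (hul ▸ hl)
      simp [hne (hu.trans h2 hl), hne (hv.trans h2 hl), hul, hne hl]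

theorem VarRevlexGt.ne {V : Type*} {vgt : V → V → Prop} {m m' : V →₀ ℕ}
    (h : VarRevlexGt vgt m m') : m ≠ m' := by
  rintro rfl
  rcases h with h | ⟨-, k, hk, -⟩
  · exact lt_irrefl _ h
  · exact lt_irrefl _ hk

theorem MarkedBinomial.isInitialTerm_toPoly {V K : Type*} [Field K]
    {gt : (V →₀ ℕ) → (V →₀ ℕ) → Prop} {g : MarkedBinomial V} (hgt : gt g.head g.tail)
    (hne : g.head ≠ g.tail) : IsInitialTerm gt (g.toPoly K) g.head := by
  classical
  refine ⟨by simp [toPoly, MvPolynomial.coeff_monomial, hne.symm], fun m' hm' hm'ne => ?_⟩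
  have : m' = g.tail := by
    by_contra h
    simp [toPoly, MvPolynomial.coeff_monomial, hm'ne.symm, Ne.symm h] at hm'
  exact this ▸ hgt

end GroebnerBasis

/-- For the strongly stable ideal `I = B(x_a x_b, x_c x_d)` with
`c < a ≤ b < d`, the collection
`G₂ = {T_u T_v − T_{u'} T_{v'} : uv = u'v', u, v ≻_mrlex v'}`, marked at `T_u T_v`, is a
Gröbner basis of the toric ideal `T(I) = ker φ_I` with respect to the mixed reverse
lexicographic order on `K[T_u : u ∈ B_M ∪ B_N]` (the reverse lexicographic order induced
by the variable order `T_u > T_v ⟺ u ≻_mrlex v`), with the marked terms as initial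
terms. -/
theorem G2_is_mixed_revlex_GroebnerBasis {n : ℕ} {K : Type} [Field K] (a b c d : Fin n)
    (h1 : c < a) (h2 : a ≤ b) (h3 : b < d)
    (φ : MvPolynomial ↥(BM a b ∪ BN b c d) K →ₐ[K] MvPolynomial (Fin n) K)
    (hφ : φ = MvPolynomial.aeval fun w : ↥(BM a b ∪ BN b c d) =>
      MvPolynomial.monomial (w : Fin n →₀ ℕ) (1 : K)) :
    IsMarkedGB
      (VarRevlexGt fun w w' : ↥(BM a b ∪ BN b c d) =>
        MrlexGt a b c d (w : Fin n →₀ ℕ) (w' : Fin n →₀ ℕ))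
      (G2 a b c d) (RingHom.ker φ.toRingHom) := by
  subst hφ
  have hker : ∀ g ∈ G2 a b c d, g.toPoly K ∈ RingHom.ker (MvPolynomial.aeval
      fun w : ↥(BM a b ∪ BN b c d) =>
        MvPolynomial.monomial (w : Fin n →₀ ℕ) (1 : K)).toRingHom := by
    rintro g ⟨u, v, u', v', h, -, -, hhead, htail⟩
    change MvPolynomial.aeval _ _ = 0
    rw [MarkedBinomial.toPoly, map_sub, aeval_monomial_fiberMap, aeval_monomial_fiberMap, hhead,
      htail, fiberMap_add, fiberMap_add]
    simp only [fiberMap_single]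
    rw [h, sub_self]
  refine ⟨hker, fun g hg => varRevlexGt_of_mem_G2 h2 hg, le_antisymm ?_ ?_⟩
  · refine Ideal.span_mono ?_
    rintro _ ⟨g, hg, rfl⟩
    have hgt := varRevlexGt_of_mem_G2 h2 hg
    have hinit := MarkedBinomial.isInitialTerm_toPoly (K := K) hgt hgt.ne
    refine ⟨g.toPoly K, hker g hg, ?_, g.head, hinit, rfl⟩
    intro h0
    simp [h0] at hinit
    exact absurd hinit.1 (by simp)
  · rw [Ideal.span_le]
    rintro _ ⟨f, hf, -, m, ⟨hm, hmax⟩, rfl⟩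
    obtain ⟨m', hm', hne, hfib⟩ := exists_ne_mem_support_fiberMap_eq hm hf
    obtain ⟨g, hg, hle⟩ := exists_head_le_of_varRevlexGt h1 h2 hfib.symm (hmax m' hm' hne)
    have hmon : MvPolynomial.monomial m (1 : K) =
        MvPolynomial.monomial (m - g.head) 1 * MvPolynomial.monomial g.head 1 := by
      rw [MvPolynomial.monomial_mul, tsub_add_cancel_of_le hle, one_mul]
    rw [hmon]
    exact Ideal.mul_mem_left _ _ (Ideal.subset_span ⟨g, hg, rfl⟩)
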